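/- arXiv:1710.05776 — 6 statements merged into one kernel-verified Lean document; each statement's English description precedes it below -/
import Mathlib

section
/- Let f : [a,b] → ℝ be continuous (a < b) and let Π_d be the set of real polynomials of degree at most d. A polynomial g* ∈ Π_d minimizes sup_{x ∈ [a,b]} |f(x) − g(x)| over g ∈ Π_d if and only if there exist c ∈ {−1, 1} and d+2 points a ≤ x₁ < x₂ < ... < x_{d+2} ≤ b such that f(x_i) − g*(x_i) = c·(−1)^i · sup_{x ∈ [a,b]} |f(x) − g*(x)| for every i = 1, ..., d+2. -/
open Polynomial in
/-- If `A` and `B` are disjoint compact sets of reals, every point of `B` has a point of `A` to its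
left, and there is no increasing sequence of `n + 2` points alternating between `A` and `B` and
starting in `A`, then a polynomial of degree at most `n` separates `A` from `B` by its sign. -/
lemma exists_polynomial_pos_neg_of_no_alternation (n : ℕ) :
    ∀ A B : Set ℝ, IsCompact A → IsCompact B → Disjoint A B →
      (∀ y ∈ B, ∃ x ∈ A, x < y) →
      (¬ ∃ x : Fin (n + 2) → ℝ, StrictMono x ∧ ∀ i : Fin _, x i ∈ if Even (i : ℕ) then A else B) →
      ∃ q : ℝ[X], q.natDegree ≤ n ∧ (∀ x ∈ A, 0 < q.eval x) ∧ (∀ x ∈ B, q.eval x < 0) ∧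
        ∀ x, (∀ y ∈ A, x ≤ y) → 0 < q.eval x := by
  induction n with
  | zero =>
    intro A B _ _ _ hBA hno
    have hB : ∀ y ∈ B, False := by
      intro y hy
      obtain ⟨x, hx, hxy⟩ := hBA y hy
      refine hno ⟨![x, y], ?_, ?_⟩
      · intro i j hij
        fin_cases i <;> fin_cases j <;> simp_all
      · intro i
        fin_cases i <;> simp_all
    exact ⟨1, by simp, by simp, fun x hx => (hB x hx).elim, by simp⟩
  | succ n ih =>
    intro A B hA hB hAB hBA hno
    rcases B.eq_empty_or_nonempty with rfl | hBne
    · exact ⟨1, by simp, by simp, by simp, by simp⟩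
    obtain ⟨m, hmB, hm⟩ := hB.exists_isLeast hBne
    obtain ⟨x₀, hx₀, hx₀m⟩ := hBA m hmB
    have hmA : m ∉ A := fun h => Set.disjoint_left.1 hAB h hmB
    obtain ⟨s, ⟨hsA, hsm⟩, hs⟩ :=
      (hA.inter_right (isClosed_Iic (a := m))).exists_isGreatest ⟨x₀, hx₀, hx₀m.le⟩
    have hsm' : s < m := lt_of_le_of_ne hsm (fun h => hmA (h ▸ hsA))
    obtain ⟨q, hqd, hqB, hqA, hql⟩ := ih B (A ∩ Set.Ici m) hB (hA.inter_right isClosed_Ici)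
      (hAB.symm.mono_right Set.inter_subset_left)
      (fun y hy => ⟨m, hmB, lt_of_le_of_ne hy.2 (fun h => hmA (h ▸ hy.1))⟩) (by
        rintro ⟨x, hx, hxm⟩
        refine hno ⟨Fin.cons x₀ x, ?_, ?_⟩
        · have h0 : x₀ < x 0 := hx₀m.trans_le (hm (by simpa using hxm 0))
          intro i j hij
          induction j using Fin.cases with
          | zero => exact absurd hij (Fin.not_lt_zero i)
          | succ j =>
            induction i using Fin.cases with
            | zero => simpa using h0.trans_le (hx.monotone (Fin.zero_le j))
            | succ i => simpa using hx (Fin.succ_lt_succ_iff.1 hij)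
        · intro i
          induction i using Fin.cases with
          | zero => simpa using hx₀
          | succ i =>
            have := hxm i
            by_cases hi : Even (i : ℕ)
            · simpa [hi, Nat.even_add_one] using this
            · simp only [hi, if_false] at this
              simpa [hi, Nat.even_add_one] using this.1)
    refine ⟨(C ((s + m) / 2) - X) * q, ?_, ?_, ?_, ?_⟩
    · refine natDegree_mul_le.trans ?_
      have : (C ((s + m) / 2) - X : ℝ[X]).natDegree ≤ 1 :=
        (natDegree_sub_le _ _).trans (by simp)
      omega
    · intro x hx
      rw [eval_mul, eval_sub, eval_C, eval_X]
      rcases le_total x m with h | h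
      · have hxs : x ≤ s := hs ⟨hx, h⟩
        exact mul_pos (by linarith) (hql x fun y hy => h.trans (hm hy))
      · exact mul_pos_of_neg_of_neg (by linarith) (hqA x ⟨hx, h⟩)
    · intro x hx
      rw [eval_mul, eval_sub, eval_C, eval_X]
      have hxm : m ≤ x := hm hx
      exact mul_neg_of_neg_of_pos (by linarith) (hqB x hx)
    · intro x hx
      rw [eval_mul, eval_sub, eval_C, eval_X]
      have hxs := hx s hsA
      exact mul_pos (by linarith) (hql x fun y hy => by linarith [hm hy])

/-- If `q` has the sign of `e` wherever `|e|` attains the bound `E` on a compact set, then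
subtracting a small multiple of `q` from `e` makes `|e|` strictly smaller than `E`. -/
lemma exists_abs_sub_mul_lt {K : Set ℝ} (hK : IsCompact K) {e q : ℝ → ℝ}
    (he : ContinuousOn e K) (hq : ContinuousOn q K) {E : ℝ} (hE : 0 < E)
    (hle : ∀ x ∈ K, |e x| ≤ E) (hpos : ∀ x ∈ K, e x = E → 0 < q x)
    (hneg : ∀ x ∈ K, e x = -E → q x < 0) :
    ∃ t : ℝ, ∀ x ∈ K, |e x - t * q x| < E := by
  obtain ⟨M, hM⟩ := hK.exists_bound_of_continuousOn hq
  set L := K ∩ (fun x => e x * q x) ⁻¹' Set.Iic 0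
  have hLc : IsCompact L := by
    refine hK.of_isClosed_subset ?_ Set.inter_subset_left
    exact (he.mul hq).preimage_isClosed_of_isClosed hK.isClosed isClosed_Iic
  obtain ⟨E', hE'0, hE', hLE⟩ : ∃ E', 0 ≤ E' ∧ E' < E ∧ ∀ x ∈ L, |e x| ≤ E' := by
    rcases L.eq_empty_or_nonempty with h | h
    · exact ⟨0, le_rfl, hE, by simp [h]⟩
    · obtain ⟨y, hy, hmax⟩ := hLc.exists_isMaxOn h (he.mono Set.inter_subset_left).abs
      refine ⟨|e y|, abs_nonneg _, lt_of_le_of_ne (hle y hy.1) fun h => ?_, fun x hx => hmax hx⟩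
      have hy0 : e y * q y ≤ 0 := hy.2
      rcases (abs_eq hE.le).1 h with h | h
      · have := hpos y hy.1 h
        rw [h] at hy0
        nlinarith [mul_pos hE this]
      · have := hneg y hy.1 h
        rw [h] at hy0
        nlinarith [mul_pos hE (neg_pos.2 this)]
  have hM1 : 0 < |M| + 1 := by positivity
  set t := (E - E') / (|M| + 1) with ht
  have ht0 : 0 < t := div_pos (by linarith) hM1
  have htM : t * (|M| + 1) = E - E' := by rw [ht]; field_simp
  refine ⟨t, fun x hx => ?_⟩
  have hqx : |q x| ≤ |M| := (hM x hx).trans (le_abs_self M)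
  have htq : |t * q x| < E - E' := by
    rw [abs_mul, abs_of_pos ht0]
    nlinarith
  rw [abs_lt] at htq
  have hex := abs_le.1 (hle x hx)
  by_cases hxL : x ∈ L
  · have := abs_le.1 (hLE x hxL)
    rw [abs_lt]
    constructor <;> linarith
  · have hprod : 0 < e x * q x := by
      by_contra h
      exact hxL ⟨hx, not_lt.1 h⟩
    rw [abs_lt]
    rcases mul_pos_iff.1 hprod with ⟨h1, h2⟩ | ⟨h1, h2⟩
    · have := mul_pos ht0 h2
      constructor <;> linarith
    · have := mul_neg_of_pos_of_neg ht0 h2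
      constructor <;> linarith

open Polynomial in
/-- A real polynomial of degree at most `d` does not change sign at `d + 1` consecutive pairs among
`d + 2` increasing points. -/
lemma not_forall_eval_mul_eval_neg {d : ℕ} {q : ℝ[X]} (hq : q.degree ≤ d)
    {x : Fin (d + 2) → ℝ} (hx : StrictMono x) :
    ¬ ∀ i : Fin (d + 1), q.eval (x i.castSucc) * q.eval (x i.succ) < 0 := by
  intro h
  have hroot : ∀ i : Fin (d + 1), ∃ z ∈ Set.Ioo (x i.castSucc) (x i.succ), q.eval z = 0 := by
    intro i
    have hlt := hx (Fin.castSucc_lt_succ (i := i))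
    rcases mul_neg_iff.1 (h i) with ⟨h1, h2⟩ | ⟨h1, h2⟩
    · exact intermediate_value_Ioo' hlt.le q.continuous.continuousOn ⟨h2, h1⟩
    · exact intermediate_value_Ioo hlt.le q.continuous.continuousOn ⟨h1, h2⟩
  choose z hz hz0 using hroot
  have hzm : StrictMono z := by
    intro i j hij
    exact (hz i).2.trans ((hx.monotone (Fin.succ_le_castSucc_iff.2 hij)).trans_lt (hz j).1)
  have hq0 : q = 0 := by
    refine eq_zero_of_natDegree_lt_card_of_eval_eq_zero q hzm.injective hz0 ?_
    rw [Fintype.card_fin]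
    exact Nat.lt_succ_of_le (natDegree_le_of_degree_le hq)
  simpa [hq0] using h 0

/-- Chebyshev equioscillation theorem: a polynomial `g` of degree at most `d` minimizes the
uniform error `sup_{x ∈ [a,b]} |f x - p x|` over polynomials `p` of degree at most `d` iff
there are `c ∈ {-1, 1}` and `d + 2` points `a ≤ x₁ < ... < x_{d+2} ≤ b` with
`f xᵢ - g xᵢ = c * (-1)^i * sup_{x ∈ [a,b]} |f x - g x|`. -/
theorem chebyshev_equioscillation (a b : ℝ) (hab : a < b) (d : ℕ) (f : ℝ → ℝ)
    (hf : ContinuousOn f (Set.Icc a b)) (g : Polynomial ℝ) (hg : g.degree ≤ (d : WithBot ℕ)) :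
    (∀ p : Polynomial ℝ, p.degree ≤ (d : WithBot ℕ) →
        sSup ((fun x => |f x - g.eval x|) '' Set.Icc a b) ≤
          sSup ((fun x => |f x - p.eval x|) '' Set.Icc a b)) ↔
      ∃ c : ℝ, (c = -1 ∨ c = 1) ∧ ∃ x : Fin (d + 2) → ℝ,
        StrictMono x ∧ a ≤ x 0 ∧ x (Fin.last (d + 1)) ≤ b ∧
        ∀ i : Fin (d + 2), f (x i) - g.eval (x i) =
          c * (-1 : ℝ) ^ ((i : ℕ) + 1) * sSup ((fun x => |f x - g.eval x|) '' Set.Icc a b) := by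
  have hcont : ∀ p : Polynomial ℝ, ContinuousOn (fun x => f x - p.eval x) (Set.Icc a b) :=
    fun p => hf.sub p.continuous.continuousOn
  have hle : ∀ p : Polynomial ℝ, ∀ x ∈ Set.Icc a b,
      |f x - p.eval x| ≤ sSup ((fun x => |f x - p.eval x|) '' Set.Icc a b) := fun p x hx =>
    le_csSup (isCompact_Icc.bddAbove_image (hcont p).abs) (Set.mem_image_of_mem _ hx)
  have hattain : ∀ p : Polynomial ℝ, ∃ x ∈ Set.Icc a b,
      sSup ((fun x => |f x - p.eval x|) '' Set.Icc a b) = |f x - p.eval x| := fun p =>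
    isCompact_Icc.exists_sSup_image_eq (Set.nonempty_Icc.2 hab.le) (hcont p).abs
  set E := sSup ((fun x => |f x - g.eval x|) '' Set.Icc a b) with hEdef
  constructor
  · intro hmin
    obtain ⟨y, hy, hyE⟩ := hattain g
    rw [← hEdef] at hyE
    rcases (hyE ▸ abs_nonneg _ : 0 ≤ E).eq_or_lt with hE | hE
    · have h0 : 0 < (b - a) / (d + 1) := div_pos (by linarith) (by positivity)
      have hmem : ∀ i : Fin (d + 2), a + (i : ℕ) * ((b - a) / (d + 1)) ∈ Set.Icc a b := by
        intro i
        have hi : ((i : ℕ) : ℝ) ≤ d + 1 := by exact_mod_cast Nat.lt_succ_iff.1 i.2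
        have hd : ((d : ℝ) + 1) * ((b - a) / (d + 1)) = b - a := by field_simp
        constructor
        · have := mul_nonneg (Nat.cast_nonneg (α := ℝ) (i : ℕ)) h0.le
          linarith
        · nlinarith [mul_le_mul_of_nonneg_right hi h0.le]
      refine ⟨1, Or.inr rfl, fun i => a + (i : ℕ) * ((b - a) / (d + 1)), ?_, (hmem _).1,
        (hmem _).2, fun i => ?_⟩
      · intro i j hij
        have hij' : ((i : ℕ) : ℝ) < (j : ℕ) := by exact_mod_cast hij
        have := mul_lt_mul_of_pos_right hij' h0
        simpa using this
      · have := hle g _ (hmem i)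
        rw [← hEdef, ← hE] at this
        rw [← hE, mul_zero]
        exact abs_nonpos_iff.1 this
    · have hnosep : ¬ ∃ q : Polynomial ℝ, q.natDegree ≤ d ∧
          (∀ x ∈ Set.Icc a b, f x - g.eval x = E → 0 < q.eval x) ∧
          (∀ x ∈ Set.Icc a b, f x - g.eval x = -E → q.eval x < 0) := by
        rintro ⟨q, hqd, hqpos, hqneg⟩
        obtain ⟨t, ht⟩ := exists_abs_sub_mul_lt isCompact_Icc (hcont g)
          q.continuous.continuousOn hE (hle g) hqpos hqneg
        have hdeg : (g + Polynomial.C t * q).degree ≤ (d : WithBot ℕ) := by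
          refine (Polynomial.degree_add_le _ _).trans (max_le hg ?_)
          exact Polynomial.degree_le_of_natDegree_le ((Polynomial.natDegree_C_mul_le t q).trans hqd)
        have h := hmin _ hdeg
        obtain ⟨z, hz, hzE⟩ := hattain (g + Polynomial.C t * q)
        rw [hzE] at h
        refine absurd (ht z hz) (not_lt.2 ?_)
        simpa [sub_add_eq_sub_sub] using h
      have hcompact : ∀ v, IsCompact (Set.Icc a b ∩ (fun x => f x - g.eval x) ⁻¹' {v}) := fun v =>
        isCompact_Icc.of_isClosed_subset
          ((hcont g).preimage_isClosed_of_isClosed isClosed_Icc isClosed_singleton)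
          Set.inter_subset_left
      set A := Set.Icc a b ∩ (fun x => f x - g.eval x) ⁻¹' {E}
      set B := Set.Icc a b ∩ (fun x => f x - g.eval x) ⁻¹' {-E}
      have hdisj : Disjoint A B := by
        rw [Set.disjoint_left]
        rintro x ⟨-, h1⟩ ⟨-, h2⟩
        simp only [Set.mem_preimage, Set.mem_singleton_iff] at h1 h2
        linarith
      have hyAB : y ∈ A ∪ B := by
        rcases (abs_eq hE.le).1 hyE.symm with h | h
        · exact Or.inl ⟨hy, h⟩
        · exact Or.inr ⟨hy, h⟩
      obtain ⟨m, hmAB, hm⟩ := ((hcompact E).union (hcompact (-E))).exists_isLeast ⟨y, hyAB⟩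
      rcases hmAB with hmA | hmB
      · have hBA : ∀ y ∈ B, ∃ x ∈ A, x < y := fun y hy =>
          ⟨m, hmA, lt_of_le_of_ne (hm (Or.inr hy))
            fun h => Set.disjoint_left.1 hdisj hmA (h ▸ hy)⟩
        by_cases halt : ∃ x : Fin (d + 2) → ℝ,
            StrictMono x ∧ ∀ i : Fin _, x i ∈ if Even (i : ℕ) then A else B
        · obtain ⟨x, hx, hxm⟩ := halt
          have hval : ∀ i, x i ∈ Set.Icc a b ∧
              f (x i) - g.eval (x i) = -1 * (-1 : ℝ) ^ ((i : ℕ) + 1) * E := by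
            intro i
            have := hxm i
            split_ifs at this with hi
            · exact ⟨this.1, by simpa [pow_succ, hi.neg_one_pow] using this.2⟩
            · exact ⟨this.1,
                by simpa [pow_succ, (Nat.not_even_iff_odd.1 hi).neg_one_pow] using this.2⟩
          exact ⟨-1, Or.inl rfl, x, hx, (hval _).1.1, (hval _).1.2, fun i => (hval i).2⟩
        · obtain ⟨q, hqd, hqA, hqB, -⟩ := exists_polynomial_pos_neg_of_no_alternation d A B
            (hcompact E) (hcompact (-E)) hdisj hBA halt
          exact (hnosep ⟨q, hqd, fun x hx h => hqA x ⟨hx, h⟩, fun x hx h => hqB x ⟨hx, h⟩⟩).elim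
      · have hAB : ∀ y ∈ A, ∃ x ∈ B, x < y := fun y hy =>
          ⟨m, hmB, lt_of_le_of_ne (hm (Or.inl hy))
            fun h => Set.disjoint_left.1 hdisj hy (h ▸ hmB)⟩
        by_cases halt : ∃ x : Fin (d + 2) → ℝ,
            StrictMono x ∧ ∀ i : Fin _, x i ∈ if Even (i : ℕ) then B else A
        · obtain ⟨x, hx, hxm⟩ := halt
          have hval : ∀ i, x i ∈ Set.Icc a b ∧
              f (x i) - g.eval (x i) = 1 * (-1 : ℝ) ^ ((i : ℕ) + 1) * E := by
            intro i
            have := hxm i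
            split_ifs at this with hi
            · exact ⟨this.1, by simpa [pow_succ, hi.neg_one_pow] using this.2⟩
            · exact ⟨this.1,
                by simpa [pow_succ, (Nat.not_even_iff_odd.1 hi).neg_one_pow] using this.2⟩
          exact ⟨1, Or.inr rfl, x, hx, (hval _).1.1, (hval _).1.2, fun i => (hval i).2⟩
        · obtain ⟨q, hqd, hqB, hqA, -⟩ := exists_polynomial_pos_neg_of_no_alternation d B A
            (hcompact (-E)) (hcompact E) hdisj.symm hAB halt
          refine (hnosep ⟨-q, by simpa using hqd, fun x hx h => ?_, fun x hx h => ?_⟩).elim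
          · simpa using hqA x ⟨hx, h⟩
          · simpa using hqB x ⟨hx, h⟩
  · rintro ⟨c, hc, x, hx, hxa, hxb, hval⟩ p hp
    by_contra! hlt
    have hdeg : (p - g).degree ≤ (d : WithBot ℕ) :=
      (Polynomial.degree_sub_le _ _).trans (max_le hp hg)
    refine not_forall_eval_mul_eval_neg hdeg hx fun i => ?_
    have hmem : ∀ j, x j ∈ Set.Icc a b := fun j =>
      ⟨hxa.trans (hx.monotone (Fin.zero_le j)), (hx.monotone (Fin.le_last j)).trans hxb⟩
    have h1 := abs_lt.1 ((hle p _ (hmem i.castSucc)).trans_lt hlt)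
    have h2 := abs_lt.1 ((hle p _ (hmem i.succ)).trans_lt hlt)
    have v1 := hval i.castSucc
    have v2 := hval i.succ
    rw [Fin.val_castSucc] at v1
    rw [Fin.val_succ, pow_succ] at v2
    have hs : c * (-1 : ℝ) ^ ((i : ℕ) + 1) = 1 ∨ c * (-1 : ℝ) ^ ((i : ℕ) + 1) = -1 := by
      rcases hc with rfl | rfl <;> rcases neg_one_pow_eq_or ℝ ((i : ℕ) + 1) with h | h <;>
        simp [h]
    rw [← mul_assoc, mul_neg_one] at v2
    rw [Polynomial.eval_sub, Polynomial.eval_sub]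
    rcases hs with hs | hs <;> rw [hs] at v1 v2
    · exact mul_neg_of_pos_of_neg (by linarith) (by linarith)
    · exact mul_neg_of_neg_of_pos (by linarith) (by linarith)
end

section
/- Let f : ℝ^{m×n} → ℝ be continuous and separable, i.e., f(X) = Σ_{i,j} f_ij(X_ij) where each f_ij : ℝ → ℝ is continuous. Fix X ∈ ℝ^{m×n} and τ > 0. For each (i,j), let ℓ_ij be a polynomial of degree at most 1 minimizing sup_{y ∈ [X_ij − τ, X_ij + τ]} |f_ij(y) − p(y)| over polynomials p of degree at most 1. Then the affine function ℓ(Y) = Σ_{i,j} ℓ_ij(Y_ij) minimizes sup_{Y : max_{i,j}|Y_ij − X_ij| ≤ τ} |f(Y) − b − ⟨Y − X, ξ⟩| over all pairs (ξ, b) ∈ ℝ^{m×n} × ℝ, where ⟨A, B⟩ = Σ_{i,j} A_ij B_ij. -/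
/-- If `q` is at least as good a uniform approximation of `g` on `[x - τ, x + τ]` as every
polynomial of degree at most `1`, then for every slope `c` the oscillation of `y ↦ g y - (y - x) c`
is at least twice the error of `q`, and it is attained. -/
theorem exists_two_mul_sSup_abs_sub_eval_le {g : ℝ → ℝ} (hg : Continuous g) (x c : ℝ) {τ : ℝ}
    (hτ : 0 ≤ τ) {q : Polynomial ℝ}
    (hq : ∀ p : Polynomial ℝ, p.degree ≤ (1 : WithBot ℕ) →
      sSup ((fun y => |g y - q.eval y|) '' Set.Icc (x - τ) (x + τ)) ≤
        sSup ((fun y => |g y - p.eval y|) '' Set.Icc (x - τ) (x + τ))) :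
    ∃ u ∈ Set.Icc (x - τ) (x + τ), ∃ v ∈ Set.Icc (x - τ) (x + τ),
      2 * sSup ((fun y => |g y - q.eval y|) '' Set.Icc (x - τ) (x + τ)) ≤
        (g u - (u - x) * c) - (g v - (v - x) * c) := by
  have hne : (Set.Icc (x - τ) (x + τ)).Nonempty := ⟨x, by constructor <;> linarith⟩
  have hcont : Continuous fun y => g y - (y - x) * c := by fun_prop
  obtain ⟨u, hu, hmax⟩ := isCompact_Icc.exists_isMaxOn hne hcont.continuousOn
  obtain ⟨v, hv, hmin⟩ := isCompact_Icc.exists_isMinOn hne hcont.continuousOn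
  refine ⟨u, hu, v, hv, ?_⟩
  set M := g u - (u - x) * c with hM
  set N := g v - (v - x) * c with hN
  have hp := hq (Polynomial.C c * Polynomial.X + Polynomial.C ((M + N) / 2 - c * x))
    Polynomial.degree_linear_le
  have hle : sSup ((fun y => |g y - (Polynomial.C c * Polynomial.X +
      Polynomial.C ((M + N) / 2 - c * x)).eval y|) '' Set.Icc (x - τ) (x + τ)) ≤ (M - N) / 2 := by
    refine csSup_le (hne.image _) ?_
    rintro _ ⟨y, hy, rfl⟩
    have h1 : g y - (y - x) * c ≤ M := hmax hy
    have h2 : N ≤ g y - (y - x) * c := hmin hy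
    simp only [Polynomial.eval_add, Polynomial.eval_mul, Polynomial.eval_C, Polynomial.eval_X]
    rw [abs_le]
    constructor <;> linarith
  linarith

/-- For a separable continuous function `f(Y) = Σ_{i,j} f_ij (Y_ij)`, if each `ℓ_ij` is a
degree-at-most-1 Chebyshev (minimax) approximation of `f_ij` on `[X_ij - τ, X_ij + τ]`, then
`ℓ(Y) = Σ_{i,j} ℓ_ij(Y_ij)` minimizes `sup_{‖Y - X‖_∞ ≤ τ} |f(Y) - b - ⟨Y - X, ξ⟩|` over all
affine functions `Y ↦ b + ⟨Y - X, ξ⟩`. -/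
theorem separable_uniform_affine_approx (m n : ℕ) (f : Fin m → Fin n → ℝ → ℝ)
    (hf : ∀ i j, Continuous (f i j)) (X : Fin m → Fin n → ℝ) (τ : ℝ) (hτ : 0 < τ)
    (ℓ : Fin m → Fin n → Polynomial ℝ)
    (hdeg : ∀ i j, (ℓ i j).degree ≤ (1 : WithBot ℕ))
    (hcheb : ∀ i j, ∀ p : Polynomial ℝ, p.degree ≤ (1 : WithBot ℕ) →
      sSup ((fun y => |f i j y - (ℓ i j).eval y|) '' Set.Icc (X i j - τ) (X i j + τ)) ≤
        sSup ((fun y => |f i j y - p.eval y|) '' Set.Icc (X i j - τ) (X i j + τ)))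
    (ξ : Fin m → Fin n → ℝ) (b : ℝ) :
    sSup ((fun Y : Fin m → Fin n → ℝ =>
          |(∑ i, ∑ j, f i j (Y i j)) - ∑ i, ∑ j, (ℓ i j).eval (Y i j)|) ''
        {Y : Fin m → Fin n → ℝ | ∀ i j, |Y i j - X i j| ≤ τ}) ≤
      sSup ((fun Y : Fin m → Fin n → ℝ =>
          |(∑ i, ∑ j, f i j (Y i j)) - b - ∑ i, ∑ j, (Y i j - X i j) * ξ i j|) ''
        {Y : Fin m → Fin n → ℝ | ∀ i j, |Y i j - X i j| ≤ τ}) := by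
  have hmem : ∀ i j y, |y - X i j| ≤ τ ↔ y ∈ Set.Icc (X i j - τ) (X i j + τ) := by
    intro i j y
    rw [abs_le, Set.mem_Icc]
    constructor <;> rintro ⟨h1, h2⟩ <;> constructor <;> linarith
  choose u hu v hv huv using fun i j =>
    exists_two_mul_sSup_abs_sub_eval_le (hf i j) (X i j) (ξ i j) hτ.le (hcheb i j)
  set E : Fin m → Fin n → ℝ := fun i j =>
    sSup ((fun y => |f i j y - (ℓ i j).eval y|) '' Set.Icc (X i j - τ) (X i j + τ))
  have hE : ∀ i j, ∀ y ∈ Set.Icc (X i j - τ) (X i j + τ),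
      |f i j y - (ℓ i j).eval y| ≤ E i j := by
    intro i j y hy
    have hc : Continuous fun y => |f i j y - (ℓ i j).eval y| :=
      ((hf i j).sub (ℓ i j).continuous).abs
    exact le_csSup (isCompact_Icc.image hc).bddAbove ⟨y, hy, rfl⟩
  have hcompact : IsCompact {Y : Fin m → Fin n → ℝ | ∀ i j, |Y i j - X i j| ≤ τ} := by
    have h := isCompact_univ_pi fun i => isCompact_univ_pi fun j =>
      isCompact_Icc (a := X i j - τ) (b := X i j + τ)
    convert h using 1
    ext Y
    simp only [Set.mem_ofPred_eq, Set.mem_univ_pi, hmem]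
  have hbdd := (hcompact.image (f := fun Y : Fin m → Fin n → ℝ =>
    |(∑ i, ∑ j, f i j (Y i j)) - b - ∑ i, ∑ j, (Y i j - X i j) * ξ i j|)
    (by fun_prop)).bddAbove
  have hu' := le_csSup hbdd ⟨u, fun i j => (hmem i j _).2 (hu i j), rfl⟩
  have hv' := le_csSup hbdd ⟨v, fun i j => (hmem i j _).2 (hv i j), rfl⟩
  have hsum : 2 * ∑ i, ∑ j, E i j ≤
      ((∑ i, ∑ j, f i j (u i j)) - ∑ i, ∑ j, (u i j - X i j) * ξ i j) -
        ((∑ i, ∑ j, f i j (v i j)) - ∑ i, ∑ j, (v i j - X i j) * ξ i j) := by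
    simp only [Finset.mul_sum, ← Finset.sum_sub_distrib]
    exact Finset.sum_le_sum fun i _ => Finset.sum_le_sum fun j _ => huv i j
  refine le_trans (b := ∑ i, ∑ j, E i j) ?_ ?_
  · refine csSup_le (Set.Nonempty.image _ ⟨u, fun i j => (hmem i j _).2 (hu i j)⟩) ?_
    rintro _ ⟨Y, hY, rfl⟩
    simp only [← Finset.sum_sub_distrib]
    refine (Finset.abs_sum_le_sum_abs _ _).trans (Finset.sum_le_sum fun i _ => ?_)
    exact (Finset.abs_sum_le_sum_abs _ _).trans
      (Finset.sum_le_sum fun j _ => hE i j _ ((hmem i j _).1 (hY i j)))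
  · have h1 := (le_abs_self _).trans hu'
    have h2 := (neg_le_abs _).trans hv'
    linarith
end

section
/- Let f : ℝ → ℝ be convex, let a < b, and let c ∈ (a,b) be a point at which the slope s = (f(b) − f(a))/(b − a) is a subgradient of f. Define h⁺(x) = f(a) + s·(x − a) and ℓ(x) = (f(c) + h⁺(c))/2 + s·(x − c). Then ℓ minimizes sup_{x ∈ [a,b]} |f(x) − p(x)| over all affine functions p : ℝ → ℝ. -/
/-- A convex function lies below its secant line between the endpoints. -/
lemma ConvexOn.le_secant_line {f : ℝ → ℝ} {s : Set ℝ} (hf : ConvexOn ℝ s f) {a b x : ℝ}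
    (ha : a ∈ s) (hb : b ∈ s) (hab : a < b) (hx : x ∈ Set.Icc a b) :
    f x ≤ f a + (f b - f a) / (b - a) * (x - a) := by
  have hba : 0 < b - a := sub_pos.mpr hab
  have key : (b - a) * f x ≤ (b - x) * f a + (x - a) * f b := by
    rcases hx.1.eq_or_lt with rfl | hax
    · simp
    rcases hx.2.eq_or_lt with rfl | hxb
    · simp
    exact hf.secant_mono_aux1 ha hb hax hxb
  have hsecant : (b - a) * (f a + (f b - f a) / (b - a) * (x - a)) =
      (b - x) * f a + (x - a) * f b := by
    field_simp
    ring
  exact le_of_mul_le_mul_left (hsecant ▸ key) hba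

/-- For a convex `f` on `[a,b]`, with `c ∈ (a,b)` a point where the secant slope
`s = (f b - f a)/(b - a)` is a subgradient, the line
`ℓ(x) = (f c + h⁺ c)/2 + s (x - c)` (where `h⁺(x) = f a + s (x - a)`) is the best uniform
affine approximation of `f` on `[a,b]`. -/
theorem best_affine_approx_convex (f : ℝ → ℝ) (hf : ConvexOn ℝ Set.univ f) (a b c : ℝ)
    (hab : a < b) (hc : c ∈ Set.Ioo a b)
    (hsub : ∀ y : ℝ, f y ≥ f c + (f b - f a) / (b - a) * (y - c)) :
    ∀ α β : ℝ,
      sSup ((fun x =>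
          |f x - ((f c + (f a + (f b - f a) / (b - a) * (c - a))) / 2 +
            (f b - f a) / (b - a) * (x - c))|) '' Set.Icc a b) ≤
        sSup ((fun x => |f x - (α * x + β)|) '' Set.Icc a b) := by
  intro α β
  obtain ⟨hac, hcb⟩ := hc
  have hba : 0 < b - a := sub_pos.mpr hab
  have hs : (f b - f a) / (b - a) * (b - a) = f b - f a := div_mul_cancel₀ _ hba.ne'
  have hupper : ∀ x ∈ Set.Icc a b, f x ≤ f a + (f b - f a) / (b - a) * (x - a) :=
    fun x hx => hf.le_secant_line (Set.mem_univ a) (Set.mem_univ b) hab hx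
  set s := (f b - f a) / (b - a)
  have hcont : Continuous f := continuousOn_univ.mp (hf.continuousOn isOpen_univ)
  have hbdd : BddAbove ((fun x => |f x - (α * x + β)|) '' Set.Icc a b) :=
    (isCompact_Icc.image (by fun_prop)).bddAbove
  have hle : ∀ x ∈ Set.Icc a b, |f x - (α * x + β)| ≤
      sSup ((fun x => |f x - (α * x + β)|) '' Set.Icc a b) :=
    fun x hx => le_csSup hbdd (Set.mem_image_of_mem _ hx)
  set M := sSup ((fun x => |f x - (α * x + β)|) '' Set.Icc a b)
  have hMa := (abs_le.mp (hle a ⟨le_rfl, hab.le⟩)).2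
  have hMb := (abs_le.mp (hle b ⟨hab.le, le_rfl⟩)).2
  have hMc := (abs_le.mp (hle c ⟨hac.le, hcb.le⟩)).1
  have hsecant : f a + s * (c - a) ≤ α * c + β + M := by
    refine le_of_mul_le_mul_left ?_ hba
    have h₁ := mul_le_mul_of_nonneg_left hMa (sub_pos.mpr hcb).le
    have h₂ := mul_le_mul_of_nonneg_left hMb (sub_pos.mpr hac).le
    linear_combination h₁ + h₂ + (c - a) * hs
  refine csSup_le ((Set.nonempty_Icc.mpr hab.le).image _) ?_
  rintro _ ⟨x, hx, rfl⟩
  exact abs_le.mpr ⟨by linarith [hsub x], by linarith [hupper x hx]⟩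
end

section
/- Let f : ℝ → ℝ be convex and let a < b. Then there exists c ∈ (a,b) such that the slope (f(b) − f(a))/(b − a) is a subgradient of f at c, i.e., f(y) ≥ f(c) + ((f(b) − f(a))/(b − a))·(y − c) for all y ∈ ℝ. -/
open Filter Topology in
/-- A local maximum of a convex function on the real line is also a local minimum. -/
theorem ConvexOn.isLocalMin_of_isLocalMax {g : ℝ → ℝ} (hg : ConvexOn ℝ Set.univ g) {c : ℝ}
    (hc : IsLocalMax g c) : IsLocalMin g c := by
  have hrefl : Tendsto (fun x : ℝ => 2 * c - x) (𝓝 c) (𝓝 c) := by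
    have h : Continuous fun x : ℝ => 2 * c - x := by fun_prop
    convert h.tendsto c using 2
    ring
  filter_upwards [hrefl.eventually hc] with x hx
  have hmid := hg.2 (Set.mem_univ x) (Set.mem_univ (2 * c - x))
    (by norm_num : (0 : ℝ) ≤ 1 / 2) (by norm_num : (0 : ℝ) ≤ 1 / 2) (by norm_num)
  have hcenter : (1 / 2 : ℝ) • x + (1 / 2 : ℝ) • (2 * c - x) = c := by
    simp only [smul_eq_mul]
    ring
  rw [hcenter] at hmid
  simp only [smul_eq_mul] at hmid
  linarith

/-- A convex function on the real line with equal values at `a < b` attains its global minimum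
in `(a, b)`. -/
theorem ConvexOn.exists_mem_Ioo_forall_le {g : ℝ → ℝ} (hg : ConvexOn ℝ Set.univ g) {a b : ℝ}
    (hab : a < b) (h : g a = g b) : ∃ c ∈ Set.Ioo a b, ∀ y, g c ≤ g y := by
  obtain ⟨c, hc, hext⟩ :=
    exists_isLocalExtr_Ioo hab ((hg.continuousOn isOpen_univ).mono (Set.subset_univ _)) h
  exact ⟨c, hc, IsMinOn.of_isLocalMin_of_convex_univ
    (hext.elim id hg.isLocalMin_of_isLocalMax) hg⟩

/-- Convex mean value theorem: for convex `f : ℝ → ℝ` and `a < b`, there is `c ∈ (a,b)` such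
that the secant slope `(f b - f a)/(b - a)` is a subgradient of `f` at `c`. -/
theorem convex_mean_value (f : ℝ → ℝ) (hf : ConvexOn ℝ Set.univ f) (a b : ℝ) (hab : a < b) :
    ∃ c ∈ Set.Ioo a b, ∀ y : ℝ, f y ≥ f c + (f b - f a) / (b - a) * (y - c) := by
  set m := (f b - f a) / (b - a)
  have hg : ConvexOn ℝ Set.univ fun x => f x - m * x :=
    hf.sub ((LinearMap.mulLeft ℝ m).concaveOn convex_univ)
  have hslope : m * (b - a) = f b - f a := div_mul_cancel₀ _ (sub_ne_zero.2 hab.ne')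
  obtain ⟨c, hc, hmin⟩ := hg.exists_mem_Ioo_forall_le hab (by linarith)
  refine ⟨c, hc, fun y => ?_⟩
  linarith [hmin y]
end

section
/- Let f : ℝ → ℝ be convex, a ≤ b, τ > 0, and suppose f is twice differentiable on the open interval (a − τ, b + τ). Suppose K' ≥ 0 satisfies |f''(y) − f''(z)|/2 ≤ K' for all y, z ∈ (a − τ, b + τ). Then ∫_a^b |m_f(x, τ) − f'(x)| dx ≤ (b − a)·τ·K', where m_f(x, τ) = (f(x + τ) − f(x − τ))/(2τ). -/
/-- On an interval where `f''` oscillates by at most `2 * K`, the symmetric slope of `f` with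
half-width `τ` differs from `f'` by at most `τ * K`. -/
lemma abs_symmetric_slope_sub_deriv_le {f f' f'' : ℝ → ℝ} {x τ K : ℝ} (hτ : 0 < τ)
    (hd1 : ∀ y ∈ Set.Icc (x - τ) (x + τ), HasDerivAt f (f' y) y)
    (hd2 : ∀ y ∈ Set.Icc (x - τ) (x + τ), HasDerivAt f' (f'' y) y)
    (hbound : ∀ y ∈ Set.Icc (x - τ) (x + τ), ∀ z ∈ Set.Icc (x - τ) (x + τ),
      |f'' y - f'' z| / 2 ≤ K) :
    |(f (x + τ) - f (x - τ)) / (2 * τ) - f' x| ≤ τ * K := by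
  have hadd : ∀ t ∈ Set.Icc 0 τ, x + t ∈ Set.Icc (x - τ) (x + τ) := fun t ht =>
    ⟨by linarith [ht.1], by linarith [ht.2]⟩
  have hsub : ∀ t ∈ Set.Icc 0 τ, x - t ∈ Set.Icc (x - τ) (x + τ) := fun t ht =>
    ⟨by linarith [ht.2], by linarith [ht.1]⟩
  have h0 : (0 : ℝ) ∈ Set.Icc 0 τ := ⟨le_rfl, hτ.le⟩
  have hK : 0 ≤ K := (by positivity : 0 ≤ |f'' (x + 0) - f'' (x + 0)| / 2).trans
    (hbound _ (hadd 0 h0) _ (hadd 0 h0))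
  have hderiv : ∀ t ∈ Set.Icc 0 τ, |f' (x + t) + f' (x - t) - 2 * f' x| ≤ 2 * K * τ := by
    intro t ht
    have key := (convex_Icc (0 : ℝ) τ).norm_image_sub_le_of_norm_hasDerivWithin_le
      (f := fun s => f' (x + s) + f' (x - s)) (f' := fun s => f'' (x + s) - f'' (x - s))
      (C := 2 * K) (fun s hs => by
        have h := ((hd2 _ (hadd s hs)).comp_const_add x s).add
          ((hd2 _ (hsub s hs)).comp_const_sub x s)
        exact (h.congr_deriv (sub_eq_add_neg _ _).symm).hasDerivWithinAt)
      (fun s hs => by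
        rw [Real.norm_eq_abs]
        linarith [hbound _ (hadd s hs) _ (hsub s hs)]) h0 ht
    simp only [Real.norm_eq_abs, add_zero, sub_zero, abs_of_nonneg ht.1] at key
    rw [← two_mul] at key
    exact key.trans (mul_le_mul_of_nonneg_left ht.2 (by positivity))
  have key := (convex_Icc (0 : ℝ) τ).norm_image_sub_le_of_norm_hasDerivWithin_le
    (f := fun s => f (x + s) - f (x - s) - 2 * f' x * s)
    (f' := fun s => f' (x + s) + f' (x - s) - 2 * f' x)
    (C := 2 * K * τ) (fun s hs => by
      have h := (((hd1 _ (hadd s hs)).comp_const_add x s).sub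
        ((hd1 _ (hsub s hs)).comp_const_sub x s)).sub ((hasDerivAt_id s).const_mul (2 * f' x))
      exact (h.congr_deriv (by ring)).hasDerivWithinAt)
    hderiv h0 ⟨hτ.le, le_rfl⟩
  simp only [Real.norm_eq_abs, add_zero, sub_zero, sub_self, mul_zero, abs_of_pos hτ] at key
  have heq : (f (x + τ) - f (x - τ)) / (2 * τ) - f' x
      = (f (x + τ) - f (x - τ) - 2 * f' x * τ) / (2 * τ) := by
    field_simp
  rw [heq, abs_div, abs_of_pos (by positivity : 0 < 2 * τ), div_le_iff₀ (by positivity)]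
  linarith

/-- If `f` is convex and twice differentiable on `(a - τ, b + τ)` with the oscillation of
`f''/2` bounded by `K'` there, then `∫_a^b |m_f(x,τ) - f'(x)| dx ≤ (b - a) τ K'`. -/
theorem slope_minus_derivative_integral_bound (f f' f'' : ℝ → ℝ)
    (hf : ConvexOn ℝ Set.univ f) (a b τ K' : ℝ) (hab : a ≤ b) (hτ : 0 < τ) (hK' : 0 ≤ K')
    (hd1 : ∀ x ∈ Set.Ioo (a - τ) (b + τ), HasDerivAt f (f' x) x)
    (hd2 : ∀ x ∈ Set.Ioo (a - τ) (b + τ), HasDerivAt f' (f'' x) x)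
    (hbound : ∀ y ∈ Set.Ioo (a - τ) (b + τ), ∀ z ∈ Set.Ioo (a - τ) (b + τ),
      |f'' y - f'' z| / 2 ≤ K') :
    (∫ x in a..b, |(f (x + τ) - f (x - τ)) / (2 * τ) - f' x|) ≤ (b - a) * τ * K' := by
  refine (le_abs_self _).trans ?_
  rw [← Real.norm_eq_abs]
  have key := intervalIntegral.norm_integral_le_of_norm_le_const_ae (a := a) (b := b)
    (f := fun x => |(f (x + τ) - f (x - τ)) / (2 * τ) - f' x|) (C := τ * K') (by
      filter_upwards [MeasureTheory.Measure.ae_ne MeasureTheory.volume b] with x hxb hx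
      rw [Set.uIoc_of_le hab] at hx
      have hlt : x < b := lt_of_le_of_ne hx.2 hxb
      have hmem : ∀ y ∈ Set.Icc (x - τ) (x + τ), y ∈ Set.Ioo (a - τ) (b + τ) := fun y hy =>
        ⟨by linarith [hy.1, hx.1], by linarith [hy.2]⟩
      rw [Real.norm_eq_abs, abs_abs]
      exact abs_symmetric_slope_sub_deriv_le hτ (fun y hy => hd1 y (hmem y hy))
        (fun y hy => hd2 y (hmem y hy))
        (fun y hy z hz => hbound y (hmem y hy) z (hmem z hz)))
  rw [abs_of_nonneg (sub_nonneg.2 hab)] at key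
  exact key.trans_eq (by ring)
end

section
/- Let f : ℝ → ℝ be convex and L-Lipschitz, let S ⊂ ℝ be a finite set with |S| ≤ M such that f is differentiable at every point of ℝ \ S and twice differentiable at every point where it is differentiable. Fix x₀ ∈ ℝ, D > 0, τ > 0, and let Δ ≥ 0 satisfy: (i) |f''(y) − f''(z)|/2 ≤ Δ for all y, z ∈ [x₀ − τ, x₀ + D + τ] at which f'' exists, and (ii) 2|g − h| ≤ Δ whenever g is a subgradient of f at some y ∈ [x₀ − τ, x₀ + D + τ] and h is a subgradient of f at some z ∈ [x₀ − τ, x₀ + D + τ]. Then for every x ∈ [x₀, x₀ + D], |∫_{x₀}^{x} m_f(t, τ) dt + f(x₀) − f(x)| ≤ (M + 1)(1 + D)·Δ·τ, where m_f(t, τ) = (f(t + τ) − f(t − τ))/(2τ). -/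
open Set in
/-- A convex function on `ℝ` has a subgradient at every point. -/
lemma ConvexOn.exists_real_subgradient {f : ℝ → ℝ} (hf : ConvexOn ℝ univ f) (c : ℝ) :
    ∃ g : ℝ, ∀ w : ℝ, f w ≥ f c + g * (w - c) := by
  have hc : c ∈ interior (univ : Set ℝ) := by simp
  refine ⟨derivWithin f (Ioi c) c, fun w => ?_⟩
  rcases lt_trichotomy w c with hw | rfl | hw
  · have h := (hf.slope_le_leftDeriv_of_mem_interior (mem_univ w) hc hw).trans
      (hf.leftDeriv_le_rightDeriv_of_mem_interior hc)
    rw [slope_def_field, div_le_iff₀ (sub_pos.2 hw)] at h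
    linarith
  · simp
  · have h := hf.rightDeriv_le_slope_of_mem_interior hc (mem_univ w) hw
    rw [slope_def_field, le_div_iff₀ (sub_pos.2 hw)] at h
    linarith

/-- If the subgradients of a convex function over `K` oscillate by at most `C / 2`, then its
increments over steps of equal length inside `K` differ by at most `C / 2` times the step. -/
lemma ConvexOn.abs_increment_sub_increment_le {f : ℝ → ℝ} (hf : ConvexOn ℝ Set.univ f)
    {K : Set ℝ} {C : ℝ}
    (hK : ∀ y ∈ K, ∀ z ∈ K, ∀ g h : ℝ, (∀ w : ℝ, f w ≥ f y + g * (w - y)) →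
      (∀ w : ℝ, f w ≥ f z + h * (w - z)) → 2 * |g - h| ≤ C)
    {a b s : ℝ} (ha : a ∈ K) (hb : b ∈ K) (has : a + s ∈ K) (hbs : b + s ∈ K) :
    |(f (a + s) - f a) - (f (b + s) - f b)| ≤ C / 2 * |s| := by
  obtain ⟨p, hp⟩ := hf.exists_real_subgradient a
  obtain ⟨q, hq⟩ := hf.exists_real_subgradient b
  obtain ⟨p', hp'⟩ := hf.exists_real_subgradient (a + s)
  obtain ⟨q', hq'⟩ := hf.exists_real_subgradient (b + s)
  have hupper : (p' - q) * s ≤ C / 2 * |s| :=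
    (le_abs_self _).trans <| by
      rw [abs_mul]
      gcongr
      linarith [hK _ has _ hb p' q hp' hq]
  have hlower : (q' - p) * s ≤ C / 2 * |s| :=
    (le_abs_self _).trans <| by
      rw [abs_mul]
      gcongr
      linarith [hK _ hbs _ ha q' p hq' hp]
  rw [abs_le]
  constructor
  · linarith [hp (a + s), hq' b]
  · linarith [hp' a, hq (b + s)]

/-- The integral of a central difference is an integral of a difference of translates. -/
lemma Continuous.integral_central_difference {f : ℝ → ℝ} (hf : Continuous f) (a x τ : ℝ) :
    ∫ t in a..x, (f (t + τ) - f (t - τ)) = ∫ s in (-τ)..τ, (f (x + s) - f (a + s)) := by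
  have hi : ∀ u v : ℝ, IntervalIntegrable f MeasureTheory.volume u v :=
    fun u v => hf.intervalIntegrable u v
  rw [intervalIntegral.integral_sub, intervalIntegral.integral_sub,
    intervalIntegral.integral_comp_add_right, intervalIntegral.integral_comp_sub_right,
    intervalIntegral.integral_comp_add_left, intervalIntegral.integral_comp_add_left,
    intervalIntegral.integral_interval_sub_interval_comm' (hi _ _) (hi _ _) (hi _ _)]
  · simp only [sub_eq_add_neg]
  all_goals exact Continuous.intervalIntegrable (by fun_prop) _ _


/-- Per-component uniform error bound for the FWUA smoothed approximation: for a convex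
`L`-Lipschitz `f` that is differentiable off a finite set `S` with `|S| ≤ M` (and twice
differentiable wherever differentiable), if `Δ` bounds both the oscillation of `f''/2` and
twice the oscillation of subgradients over `[x₀ - τ, x₀ + D + τ]`, then for all
`x ∈ [x₀, x₀ + D]`, `|∫_{x₀}^x m_f(t,τ) dt + f x₀ - f x| ≤ (M+1)(1+D) Δ τ`. -/
theorem smoothed_approx_uniform_error (f f' f'' : ℝ → ℝ) (hconv : ConvexOn ℝ Set.univ f)
    (L : ℝ) (hLip : ∀ x y : ℝ, |f x - f y| ≤ L * |x - y|)
    (S : Finset ℝ) (M : ℕ) (hS : S.card ≤ M)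
    (hdiff : ∀ x : ℝ, x ∉ S → HasDerivAt f (f' x) x)
    (hdiff2 : ∀ x : ℝ, x ∉ S → HasDerivAt f' (f'' x) x)
    (x₀ D τ Δ : ℝ) (hD : 0 < D) (hτ : 0 < τ) (hΔ : 0 ≤ Δ)
    (hΔ1 : ∀ y ∈ Set.Icc (x₀ - τ) (x₀ + D + τ), ∀ z ∈ Set.Icc (x₀ - τ) (x₀ + D + τ),
      y ∉ S → z ∉ S → |f'' y - f'' z| / 2 ≤ Δ)
    (hΔ2 : ∀ y ∈ Set.Icc (x₀ - τ) (x₀ + D + τ), ∀ z ∈ Set.Icc (x₀ - τ) (x₀ + D + τ),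
      ∀ g h : ℝ, (∀ w : ℝ, f w ≥ f y + g * (w - y)) →
        (∀ w : ℝ, f w ≥ f z + h * (w - z)) → 2 * |g - h| ≤ Δ) :
    ∀ x ∈ Set.Icc x₀ (x₀ + D),
      |(∫ t in x₀..x, (f (t + τ) - f (t - τ)) / (2 * τ)) + f x₀ - f x| ≤
        ((M : ℝ) + 1) * (1 + D) * Δ * τ := by
  intro x hx
  have hcont : Continuous f := by
    refine (LipschitzWith.of_dist_le' (K := L) fun y z => ?_).continuous
    simpa [Real.dist_eq] using hLip y z
  have herr : (∫ t in x₀..x, (f (t + τ) - f (t - τ)) / (2 * τ)) + f x₀ - f x =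
      (∫ s in (-τ)..τ, ((f (x + s) - f x) - (f (x₀ + s) - f x₀))) / (2 * τ) := by
    have hsplit : (∫ s in (-τ)..τ, ((f (x + s) - f x) - (f (x₀ + s) - f x₀))) =
        (∫ s in (-τ)..τ, (f (x + s) - f (x₀ + s))) - 2 * τ * (f x - f x₀) := by
      simp only [sub_sub_sub_comm _ (f x)]
      rw [intervalIntegral.integral_sub, intervalIntegral.integral_const, smul_eq_mul]
      · ring
      all_goals exact Continuous.intervalIntegrable (by fun_prop) _ _
    rw [intervalIntegral.integral_div, hcont.integral_central_difference, hsplit]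
    field_simp
    ring
  have hbound : |∫ s in (-τ)..τ, ((f (x + s) - f x) - (f (x₀ + s) - f x₀))| ≤
      Δ / 2 * τ * |τ - -τ| := by
    refine intervalIntegral.norm_integral_le_of_norm_le_const (E := ℝ) fun s hs => ?_
    rw [Set.uIoc_of_le (by linarith)] at hs
    obtain ⟨hs₁, hs₂⟩ := hs
    obtain ⟨hx₁, hx₂⟩ := hx
    refine (hconv.abs_increment_sub_increment_le hΔ2 ?_ ?_ ?_ ?_).trans
      (mul_le_mul_of_nonneg_left (abs_le.2 ⟨hs₁.le, hs₂⟩) (by positivity)) <;>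
    constructor <;> linarith
  rw [show τ - -τ = 2 * τ by ring, abs_of_pos (by positivity : 0 < 2 * τ)] at hbound
  rw [herr, abs_div, abs_of_pos (by positivity : 0 < 2 * τ)]
  calc _ ≤ Δ / 2 * τ := by rwa [div_le_iff₀ (by positivity)]
    _ ≤ 1 * (Δ * τ) := by nlinarith [mul_nonneg hΔ hτ.le]
    _ ≤ ((M : ℝ) + 1) * (1 + D) * (Δ * τ) := by
      gcongr
      nlinarith [M.cast_nonneg (α := ℝ), mul_nonneg (M.cast_nonneg (α := ℝ)) hD.le]
    _ = _ := by ring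
end
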